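/- For any dimaze (D, B_0), the linkability system satisfies the independence augmentation axiom (I3): if I is a non-maximal linkable set and B is a maximal linkable set, then there exists x ∈ B \ I such that I + x is linkable. -/

import Mathlib

open Set

universe u

variable {V : Type*}

/-- A directed path in the digraph `D`: a nonempty duplicate-free list of vertices
with an edge between consecutive vertices. -/
structure DiPath {V : Type*} (D : V → V → Prop) where
  verts : List V
  ne : verts ≠ []
  nodup : verts.Nodup
  chain : verts.Chain' D

namespace DiPath

variable {D : V → V → Prop}

/-- The initial vertex of a directed path. -/
def first (p : DiPath D) : V := p.verts.head p.ne

/-- The terminal vertex of a directed path. -/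
def last (p : DiPath D) : V := p.verts.getLast p.ne

/-- The set of vertices of a directed path. -/
def vertSet (p : DiPath D) : Set V := {v | v ∈ p.verts}

/-- The set of (directed) edges of a directed path. -/
def edgeSet (p : DiPath D) : Set (V × V) := {e | e ∈ p.verts.zip p.verts.tail}

end DiPath

/-- The set of initial vertices of a collection of paths. -/
def Ini {D : V → V → Prop} (P : Set (DiPath D)) : Set V := {v | ∃ p ∈ P, p.first = v}

/-- The set of terminal vertices of a collection of paths. -/
def Ter {D : V → V → Prop} (P : Set (DiPath D)) : Set V := {v | ∃ p ∈ P, p.last = v}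

/-- All vertices used by a collection of paths. -/
def LinkVerts {D : V → V → Prop} (P : Set (DiPath D)) : Set V := ⋃ p ∈ P, p.vertSet

/-- All edges used by a collection of paths. -/
def LinkEdges {D : V → V → Prop} (P : Set (DiPath D)) : Set (V × V) := ⋃ p ∈ P, p.edgeSet

/-- A linkage in the dimaze `(D, B0)`: a set of pairwise vertex-disjoint directed
paths, each ending in `B0`. -/
def IsLinkage (D : V → V → Prop) (B0 : Set V) (P : Set (DiPath D)) : Prop :=
  (∀ p ∈ P, p.last ∈ B0) ∧
  (∀ p ∈ P, ∀ q ∈ P, p ≠ q → Disjoint p.vertSet q.vertSet)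

/-- `(D, B0)` is a dimaze: every vertex of `B0` has out-degree `0`. -/
def IsDimaze (D : V → V → Prop) (B0 : Set V) : Prop := ∀ b ∈ B0, ∀ v, ¬ D b v

/-- A set of vertices is linkable if it is the set of initial vertices of a linkage. -/
def Linkable (D : V → V → Prop) (B0 : Set V) (I : Set V) : Prop :=
  ∃ P, IsLinkage D B0 P ∧ Ini P = I

/-- A set of vertices is linkable onto `B0` if it is the set of initial vertices of
a linkage whose terminal vertices are all of `B0`. -/
def LinkableOnto (D : V → V → Prop) (B0 : Set V) (I : Set V) : Prop :=
  ∃ P, IsLinkage D B0 P ∧ Ini P = I ∧ Ter P = B0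

/-- `I` is a maximal element (w.r.t. inclusion) of the set system `Ind`. -/
def MaximalIn {α : Type*} (Ind : Set α → Prop) (I : Set α) : Prop :=
  Ind I ∧ ∀ J, Ind J → I ⊆ J → J = I

/-- The maximality axiom (IM). -/
def SatisfiesIM {α : Type*} (Ind : Set α → Prop) : Prop :=
  ∀ I X : Set α, Ind I → I ⊆ X →
    ∃ J, Ind J ∧ I ⊆ J ∧ J ⊆ X ∧ ∀ K, Ind K → K ⊆ X → J ⊆ K → K = J

/-- `Ind` is the collection of independent sets of a matroid:
axioms (I1), (I2), (I3) and (IM). -/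
def IsMatroidIndep {α : Type*} (Ind : Set α → Prop) : Prop :=
  Ind ∅ ∧
  (∀ I J : Set α, I ⊆ J → Ind J → Ind I) ∧
  (∀ I B : Set α, Ind I → ¬ MaximalIn Ind I → MaximalIn Ind B →
    ∃ x ∈ B \ I, Ind (insert x I)) ∧
  SatisfiesIM Ind

/-- The dimaze `(D, B0)` contains an alternating comb: there is an alternating ray
(given by the injective vertex sequence `f` and edge orientations `o`, with
infinitely many vertices of in-degree 2) together with a linkage of all its
in-degree-2 vertices and its first vertex onto a set of exits contained in `B0`,
by disjoint paths meeting the ray exactly at their initial vertices. -/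
def ContainsAltComb (D : V → V → Prop) (B0 : Set V) : Prop :=
  ∃ (f : ℕ → V) (o : ℕ → Bool) (P : Set (DiPath D)),
    Function.Injective f ∧
    (∀ n, if o n then D (f n) (f (n+1)) else D (f (n+1)) (f n)) ∧
    (∀ N, ∃ k ≥ N, o k = true ∧ o (k+1) = false) ∧
    IsLinkage D B0 P ∧
    Ini P = insert (f 0) {v | ∃ k, o k = true ∧ o (k+1) = false ∧ v = f (k+1)} ∧
    (∀ p ∈ P, ∀ v ∈ p.vertSet, v ∈ Set.range f → v = p.first)

def GoodF {V : Type*} (D : V → V → Prop) (B0 : Set V) (f : V → V) : Prop :=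
  (∀ u, u ∉ B0 → D u (f u) ∨ f u = u) ∧
  (∀ u v, u ∉ B0 → v ∉ B0 → f u = f v → u = v) ∧
  (∀ x : ℕ → V, (∀ n, x n ∉ B0) → (∀ n, x (n+1) = f (x n)) → ¬ Function.Injective x)

def Unm {V : Type*} (B0 : Set V) (f : V → V) (v : V) : Prop := ∀ u, u ∉ B0 → f u ≠ v

def NextP {V : Type*} {D : V → V → Prop} (P : Set (DiPath D)) (u w : V) : Prop :=
  ∃ p ∈ P, ∃ i : ℕ, p.verts[i]? = some u ∧ p.verts[i+1]? = some w

theorem idx_unique {V : Type*} {D : V → V → Prop} {B0 : Set V} {P : Set (DiPath D)}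
    (hP : IsLinkage D B0 P) {p q : DiPath D} (hp : p ∈ P) (hq : q ∈ P) {i j : ℕ} {v : V}
    (hi : p.verts[i]? = some v) (hj : q.verts[j]? = some v) : p = q ∧ i = j := by
  have hpq : p = q := by
    by_contra hne
    exact Set.disjoint_left.1 (hP.2 p hp q hq hne)
      (List.mem_of_getElem? hi : v ∈ p.verts) (List.mem_of_getElem? hj : v ∈ q.verts)
  subst hpq
  refine ⟨rfl, ?_⟩
  obtain ⟨h1, h2⟩ := List.getElem?_eq_some_iff.1 hi
  obtain ⟨h3, h4⟩ := List.getElem?_eq_some_iff.1 hj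
  exact (p.nodup.getElem_inj_iff).1 (h2.trans h4.symm)

theorem next_exists {V : Type*} {D : V → V → Prop} {B0 : Set V} {P : Set (DiPath D)}
    (hP : IsLinkage D B0 P) {p : DiPath D} (hp : p ∈ P) {i : ℕ} {v : V}
    (hi : p.verts[i]? = some v) (hv : v ∉ B0) : ∃ w, NextP P v w := by
  obtain ⟨h1, h2⟩ := List.getElem?_eq_some_iff.1 hi
  by_cases h : i + 1 < p.verts.length
  · exact ⟨p.verts[i+1], p, hp, i, hi, List.getElem?_eq_getElem h⟩
  · exfalso
    apply hv
    have := hP.1 p hp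
    unfold DiPath.last at this
    rw [List.getLast_eq_getElem] at this
    have e : p.verts.length - 1 = i := by omega
    simp only [e, h2] at this
    exact this

theorem lemA {V : Type*} {D : V → V → Prop} {B0 I : Set V} (h : Linkable D B0 I) :
    ∃ f, GoodF D B0 f ∧ ∀ v ∈ I, Unm B0 f v := by
  classical
  obtain ⟨P, hP, rfl⟩ := h
  let f : V → V := fun u => if h : ∃ w, NextP P u w then h.choose else u
  have f1 : ∀ u, NextP P u (f u) ∨ (f u = u ∧ ¬ ∃ w, NextP P u w) := by
    intro u
    by_cases h : ∃ w, NextP P u w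
    · left; simp only [f, dif_pos h]; exact h.choose_spec
    · right; simp only [f, dif_neg h]; exact ⟨trivial, h⟩
  refine ⟨f, ⟨?_, ?_, ?_⟩, ?_⟩
  · intro u _
    rcases f1 u with ⟨p, hp, i, hi, hi'⟩ | h
    · left
      obtain ⟨h1, h2⟩ := List.getElem?_eq_some_iff.1 hi
      obtain ⟨h3, h4⟩ := List.getElem?_eq_some_iff.1 hi'
      have := List.isChain_iff_getElem.1 p.chain i h3
      rwa [h2, h4] at this
    · exact Or.inr h.1
  · intro u v hu hv huv
    rcases f1 u with ⟨p, hp, i, hi, hi'⟩ | h <;> rcases f1 v with ⟨q, hq, j, hj, hj'⟩ | h'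
    · rw [← huv] at hj'
      obtain ⟨rfl, e⟩ := idx_unique hP hp hq hi' hj'
      obtain rfl : i = j := by omega
      rw [hi] at hj
      exact Option.some.inj hj
    · rw [huv, h'.1] at hi'
      exact absurd (next_exists hP hp hi' hv) h'.2
    · rw [← huv, h.1] at hj'
      exact absurd (next_exists hP hq hj' hu) h.2
    · rw [← h.1, huv, h'.1]
  · intro x hx hs hinj
    have hn : ∀ n, NextP P (x n) (x (n+1)) := by
      intro n
      rcases f1 (x n) with h | h
      · rw [hs]; exact h
      · have := hinj ((hs n).trans h.1); omega
    obtain ⟨p, hp, i, hi, hi'⟩ := hn 0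
    have : ∀ n, p.verts[i+n]? = some (x n) := by
      intro n
      induction n with
      | zero => exact hi
      | succ n ih =>
        obtain ⟨q, hq, j, hj, hj'⟩ := hn n
        obtain ⟨rfl, e⟩ := idx_unique hP hp hq ih hj
        rw [← e] at hj'
        exact hj'
    obtain ⟨h1, -⟩ := List.getElem?_eq_some_iff.1 (this p.verts.length)
    omega
  · rintro v ⟨p, hp, rfl⟩ u hu hf
    have h0 : p.verts[0]? = some p.first := by
      unfold DiPath.first
      rw [List.head_eq_getElem]
      exact List.getElem?_eq_getElem _
    rcases f1 u with ⟨q, hq, i, hi, hi'⟩ | h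
    · rw [hf] at hi'
      have := (idx_unique hP hp hq h0 hi').2
      omega
    · have e : p.first = u := hf.symm.trans h.1
      rw [e] at h0
      exact h.2 (next_exists hP hp h0 hu)

theorem lemC {V : Type*} {D : V → V → Prop} {B0 : Set V} {f : V → V} (hf : GoodF D B0 f)
    {v w : V} (hv : Unm B0 f v) (hw : Unm B0 f w) (k l : ℕ)
    (hk : ∀ j < k, f^[j] v ∉ B0) (hl : ∀ j < l, f^[j] w ∉ B0) (e : f^[k] v = f^[l] w) :
    k = l ∧ v = w := by
  induction k generalizing l with
  | zero =>
    cases l with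
    | zero => exact ⟨rfl, e⟩
    | succ l =>
      rw [Function.iterate_succ_apply'] at e
      exact absurd e.symm (hv _ (hl l (by omega)))
  | succ k ih =>
    cases l with
    | zero =>
      rw [Function.iterate_succ_apply'] at e
      exact absurd e (hw _ (hk k (by omega)))
    | succ l =>
      rw [Function.iterate_succ_apply', Function.iterate_succ_apply'] at e
      have := ih l (fun j hj => hk j (by omega)) (fun j hj => hl j (by omega))
        (hf.2.1 _ _ (hk k (by omega)) (hl l (by omega)) e)
      exact ⟨by omega, this.2⟩

theorem lemB {V : Type*} {D : V → V → Prop} {B0 I : Set V} {f : V → V} (hf : GoodF D B0 f)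
    (hI : ∀ v ∈ I, Unm B0 f v) : Linkable D B0 I := by
  classical
  have hex : ∀ v : I, ∃ n, f^[n] v.1 ∈ B0 ∧ ∀ j < n, f^[j] v.1 ∉ B0 := by
    intro v
    have : ∃ n, f^[n] v.1 ∈ B0 := by
      by_contra hcon
      push Not at hcon
      refine hf.2.2 (fun n => f^[n] v.1) hcon
        (fun n => Function.iterate_succ_apply' f n v.1) ?_
      intro a b hab
      exact (lemC hf (hI _ v.2) (hI _ v.2) a b (fun j _ => hcon j) (fun j _ => hcon j) hab).1
    exact ⟨Nat.find this, Nat.find_spec this, fun j hj => Nat.find_min this hj⟩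
  choose n hn hn' using hex
  let p : I → DiPath D := fun v =>
    { verts := (List.range (n v + 1)).map (fun k => f^[k] v.1)
      ne := by simp
      nodup := by
        refine List.Nodup.map_on ?_ List.nodup_range
        intro a ha b hb hab
        rw [List.mem_range] at ha hb
        exact (lemC hf (hI _ v.2) (hI _ v.2) a b (fun j hj => hn' v j (by omega))
          (fun j hj => hn' v j (by omega)) hab).1
      chain := by
        refine List.isChain_iff_getElem.2 ?_
        intro i hi
        simp only [List.length_map, List.length_range] at hi
        simp only [List.getElem_map, List.getElem_range]
        rw [Function.iterate_succ_apply']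
        rcases hf.1 (f^[i] v.1) (hn' v i (by omega)) with h | h
        · exact h
        · rw [← Function.iterate_succ_apply' f] at h
          have := (lemC hf (hI _ v.2) (hI _ v.2) (i+1) i (fun j hj => hn' v j (by omega))
            (fun j hj => hn' v j (by omega)) h).1
          omega }
  have hfirst : ∀ v, (p v).first = v.1 := by
    intro v
    simp [p, DiPath.first, List.head_eq_getElem]
  have hlast : ∀ v, (p v).last = f^[n v] v.1 := by
    intro v
    simp only [p, DiPath.last, List.getLast_eq_getElem, List.getElem_map, List.getElem_range,
      List.length_map, List.length_range, Nat.add_sub_cancel]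
  refine ⟨Set.range p, ⟨?_, ?_⟩, ?_⟩
  · rintro _ ⟨v, rfl⟩
    rw [hlast]; exact hn v
  · rintro _ ⟨v, rfl⟩ _ ⟨w, rfl⟩ hne
    rw [Set.disjoint_left]
    intro z hz hz'
    apply hne
    simp only [DiPath.vertSet, p, Set.mem_setOf_eq, List.mem_map, List.mem_range] at hz hz'
    obtain ⟨a, ha, rfl⟩ := hz
    obtain ⟨b, hb, e⟩ := hz'
    have := (lemC hf (hI _ v.2) (hI _ w.2) a b (fun j hj => hn' v j (by omega))
          (fun j hj => hn' w j (by omega)) e.symm).2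
    rw [Subtype.ext this]
  · ext z
    constructor
    · rintro ⟨_, ⟨v, rfl⟩, rfl⟩
      rw [hfirst]; exact v.2
    · intro hz
      exact ⟨p ⟨z, hz⟩, ⟨_, rfl⟩, hfirst _⟩

def TT {V : Type*} (D : V → V → Prop) (B0 : Set V) (f : V → V) (v0 : V) : ℕ → Set V
  | 0 => {v0}
  | n+1 => TT D B0 f v0 n ∪ {z | ∃ u, u ∉ B0 ∧ (∃ w ∈ TT D B0 f v0 n, D u w ∨ w = u) ∧ f u = z}

theorem TT_I {V : Type*} {D : V → V → Prop} {B0 I : Set V} {f : V → V}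
    {v0 : V} (hI : ∀ v ∈ I, Unm B0 f v) (h0I : v0 ∉ I) :
    ∀ n, ∀ w ∈ TT D B0 f v0 n, w ∉ I := by
  intro n
  induction n with
  | zero => rintro w rfl; exact h0I
  | succ n ih =>
    rintro w (hw | ⟨u, hu, -, rfl⟩) h
    · exact ih w hw h
    · exact hI _ h u hu rfl

theorem lemT {V : Type*} {D : V → V → Prop} {B0 I : Set V} {f : V → V} (hf : GoodF D B0 f)
    {v0 : V} (hI : ∀ v ∈ I, Unm B0 f v) (h0 : Unm B0 f v0) (h0I : v0 ∉ I) (n : ℕ) :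
    ∀ w ∈ TT D B0 f v0 n, ∃ f', GoodF D B0 f' ∧ (∀ v ∈ insert w I, Unm B0 f' v) ∧
      (∀ u, u ∉ B0 → f u ∉ TT D B0 f v0 n → f' u = f u) := by
  classical
  have hTI := TT_I (D := D) hI h0I
  induction n with
  | zero =>
    rintro w rfl
    refine ⟨f, hf, ?_, fun _ _ _ => rfl⟩
    rintro v (rfl | hv)
    · exact h0
    · exact hI v hv
  | succ n ih =>
    intro z hz
    by_cases hzn : z ∈ TT D B0 f v0 n
    · obtain ⟨f', h1, h2, h3⟩ := ih z hzn
      exact ⟨f', h1, h2, fun u hu h => h3 u hu (fun h' => h (Or.inl h'))⟩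
    · rcases hz with hz | ⟨u, hu, ⟨w, hw, huw⟩, rfl⟩
      · exact absurd hz hzn
      obtain ⟨g, hg, h2, h3⟩ := ih w hw
      have hgu : g u = f u := h3 u hu hzn
      have hgw : Unm B0 g w := h2 w (Set.mem_insert _ _)
      refine ⟨Function.update g u w, ⟨?_, ?_, ?_⟩, ?_, ?_⟩
      · intro a ha
        by_cases h : a = u
        · subst h; simpa using huw
        · rw [Function.update_of_ne h]; exact hg.1 a ha
      · intro a b ha hb hab
        by_cases h : a = u <;> by_cases h' : b = u
        · rw [h, h']
        · subst h
          rw [Function.update_self, Function.update_of_ne h'] at hab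
          exact absurd hab.symm (hgw b hb)
        · subst h'
          rw [Function.update_self, Function.update_of_ne h] at hab
          exact absurd hab (hgw a ha)
        · rw [Function.update_of_ne h', Function.update_of_ne h] at hab
          exact hg.2.1 a b ha hb hab
      · intro x hx hs hinj
        obtain ⟨N, hN⟩ : ∃ N, ∀ m, x (N + m) ≠ u := by
          by_cases h : ∃ k, x k = u
          · obtain ⟨k, hk⟩ := h
            refine ⟨k+1, fun m hm => ?_⟩
            have := hinj (hm.trans hk.symm)
            omega
          · push Not at h
            exact ⟨0, fun m => h _⟩
        refine hg.2.2 (fun m => x (N + m)) (fun m => hx _) (fun m => ?_) ?_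
        · have := hs (N + m)
          rw [Function.update_of_ne (hN m)] at this
          exact this
        · intro a b hab
          have := hinj hab
          omega
      · intro v hv a ha hav
        by_cases h : a = u
        · subst h
          rw [Function.update_self] at hav
          subst hav
          rcases hv with hv | hv
          · exact hzn (hv ▸ hw)
          · exact hTI n _ hw hv
        · rw [Function.update_of_ne h] at hav
          rcases hv with rfl | hv
          · rw [← hgu] at hav
            exact h (hg.2.1 a u ha hu hav)
          · exact h2 v (Set.mem_insert_of_mem _ hv) a ha hav
      · intro a ha h
        have hau : a ≠ u := by
          rintro rfl
          exact h (Or.inr ⟨a, ha, ⟨w, hw, huw⟩, rfl⟩)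
        rw [Function.update_of_ne hau]
        exact h3 a ha (fun h' => h (Or.inl h'))

/-- The linkability system of any dimaze satisfies the augmentation axiom (I3). -/
theorem linkability_I3 (D : V → V → Prop) (B0 : Set V) (hD : IsDimaze D B0)
    (I B : Set V) (hI : Linkable D B0 I) (hInm : ¬ MaximalIn (Linkable D B0) I)
    (hB : MaximalIn (Linkable D B0) B) :
    ∃ x ∈ B \ I, Linkable D B0 (insert x I) := by
  classical
  obtain ⟨J, hJ, hIJ, hne⟩ : ∃ J, Linkable D B0 J ∧ I ⊆ J ∧ J ≠ I := by
    by_contra hcon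
    push Not at hcon
    exact hInm ⟨hI, hcon⟩
  obtain ⟨x, hxJ, hxI⟩ : ∃ x ∈ J, x ∉ I := by
    by_contra hcon
    push Not at hcon
    exact hne (Set.Subset.antisymm hcon hIJ)
  obtain ⟨f, hf, hfJ⟩ := lemA hJ
  obtain ⟨g, hg, hgB⟩ := lemA hB.1
  by_cases hT : ∃ n, ∃ b ∈ B, b ∈ TT D B0 f x n
  · obtain ⟨n, b, hb, hbT⟩ := hT
    obtain ⟨f', h1, h2, -⟩ := lemT hf (fun v hv => hfJ v (hIJ hv)) (hfJ x hxJ) hxI n b hbT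
    by_cases hbI : b ∈ I
    · exact absurd hbI (TT_I (fun v hv => hfJ v (hIJ hv)) hxI n b hbT)
    · exact ⟨b, ⟨hb, hbI⟩, lemB h1 h2⟩
  · exfalso
    push Not at hT
    let T : Set V := {z | ∃ n, z ∈ TT D B0 f x n}
    have hxT : x ∈ T := ⟨0, rfl⟩
    have hBT : ∀ b ∈ B, b ∉ T := fun b hb ⟨n, hn⟩ => hT n b hb hn
    have hcl : ∀ u, u ∉ B0 → ∀ w ∈ T, (D u w ∨ w = u) → f u ∈ T := by
      rintro u hu w ⟨n, hn⟩ h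
      exact ⟨n+1, Or.inr ⟨u, hu, ⟨w, hn, h⟩, rfl⟩⟩
    have hclg : ∀ u, u ∉ B0 → g u ∈ T → f u ∈ T := fun u hu h => hcl u hu _ h (hg.1 u hu)
    let h : V → V := fun u => if f u ∈ T then f u else g u
    have hp : ∀ u, f u ∈ T → h u = f u := fun u hu => if_pos hu
    have hn : ∀ u, f u ∉ T → h u = g u := fun u hu => if_neg hu
    have hgood : GoodF D B0 h := by
      refine ⟨?_, ?_, ?_⟩
      · intro u hu
        by_cases c : f u ∈ T
        · rw [hp u c]; exact hf.1 u hu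
        · rw [hn u c]; exact hg.1 u hu
      · intro u v hu hv e
        by_cases c : f u ∈ T <;> by_cases c' : f v ∈ T
        · rw [hp u c, hp v c'] at e; exact hf.2.1 u v hu hv e
        · rw [hp u c, hn v c'] at e
          exact absurd (hclg v hv (e ▸ c)) c'
        · rw [hn u c, hp v c'] at e
          exact absurd (hclg u hu (e ▸ c')) c
        · rw [hn u c, hn v c'] at e; exact hg.2.1 u v hu hv e
      · intro y hy hs hinj
        by_cases c : ∃ N, f (y N) ∈ T
        · obtain ⟨N, hN⟩ := c
          have hall : ∀ m, f (y (N + m)) ∈ T := by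
            intro m
            induction m with
            | zero => exact hN
            | succ m ih =>
              have e : y (N + (m + 1)) = f (y (N + m)) := (hs (N + m)).trans (hp _ ih)
              exact hcl _ (hy _) _ ih (Or.inr e.symm)
          refine hf.2.2 (fun m => y (N + m)) (fun m => hy _)
            (fun m => (hs (N + m)).trans (hp _ (hall m))) ?_
          intro a b hab
          have := hinj hab
          omega
        · push Not at c
          exact hg.2.2 y hy (fun m => (hs m).trans (hn _ (c m))) hinj
    have hL : Linkable D B0 (insert x B) := by
      refine lemB hgood ?_
      intro v hv u hu e
      by_cases c : f u ∈ T
      · rw [hp u c] at e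
        rcases hv with rfl | hv
        · exact hfJ _ hxJ u hu e
        · exact hBT v hv (e ▸ c)
      · rw [hn u c] at e
        rcases hv with rfl | hv
        · exact c (hclg u hu (e ▸ hxT))
        · exact hgB v hv u hu e
    have := hB.2 _ hL (Set.subset_insert _ _)
    exact hBT x (this ▸ Set.mem_insert _ _) hxT
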